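/- Let F(a,b) be the free group on {a,b} and let R(x,y) be the word x y^{101} x² y^{102} ⋯ x^{100} y^{200}. The symmetrized closure (cyclic permutations of the words and their inverses) of the set {R(a,b), R(a⁻¹,b⁻¹), R(b,a), R(b⁻¹,a⁻¹)} satisfies the classical small cancellation condition C'(1/8). -/

import Mathlib

open FreeGroup

/-- The word `R(x,y) = x y^101 x² y^102 ⋯ x^100 y^200`. -/
def Rword (x y : FreeGroup (Fin 2)) : FreeGroup (Fin 2) :=
  ((List.range 100).map fun i => x ^ (i + 1) * y ^ (i + 101)).prod

/-- The four basic relators `R(a,b), R(a⁻¹,b⁻¹), R(b,a), R(b⁻¹,a⁻¹)`, where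
`a, b` are the free generators. -/
def baseRels : Set (FreeGroup (Fin 2)) :=
  {Rword (of 0) (of 1), Rword (of 0)⁻¹ (of 1)⁻¹,
   Rword (of 1) (of 0), Rword (of 1)⁻¹ (of 0)⁻¹}

/-- The symmetrized closure of `baseRels`: all cyclic permutations (of the
reduced words) of the relators and of their inverses. -/
def symRels : Set (FreeGroup (Fin 2)) :=
  {w | ∃ w₀ ∈ baseRels, ∃ n : ℕ,
    FreeGroup.toWord w = (FreeGroup.toWord w₀).rotate n ∨
    FreeGroup.toWord w = (FreeGroup.toWord w₀⁻¹).rotate n}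

/-- The word spelled by a list of syllables `(letter, exponent)`. -/
def spell {α : Type*} (S : List (α × ℕ)) : List α :=
  S.flatMap fun s => List.replicate s.2 s.1

section Spell

variable {α : Type*}

@[simp] lemma spell_nil : spell ([] : List (α × ℕ)) = [] := rfl

@[simp] lemma spell_cons (s : α × ℕ) (S : List (α × ℕ)) :
    spell (s :: S) = List.replicate s.2 s.1 ++ spell S := rfl

@[simp] lemma spell_append (S T : List (α × ℕ)) : spell (S ++ T) = spell S ++ spell T := by
  simp [spell]

lemma length_spell (S : List (α × ℕ)) : (spell S).length = (S.map Prod.snd).sum := by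
  simp [spell, List.length_flatMap]

/-- Every rotation of a spelled word cuts at most one syllable of a rotation of its syllables. -/
lemma exists_rotate_spell {S : List (α × ℕ)} (hS : S ≠ []) (hpos : ∀ s ∈ S, 0 < s.2) (n : ℕ) :
    ∃ (j : ℕ) (s : α × ℕ) (R : List (α × ℕ)) (c d : ℕ), S.rotate j = s :: R ∧ 0 < c ∧
      c + d = s.2 ∧
      (spell S).rotate n = List.replicate c s.1 ++ spell R ++ List.replicate d s.1 := by
  induction n with
  | zero =>
    obtain ⟨s, R, rfl⟩ := List.exists_cons_of_ne_nil hS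
    exact ⟨0, s, R, s.2, 0, by simp, hpos s (by simp), rfl, by simp⟩
  | succ n ih =>
    obtain ⟨j, s, R, c, d, hj, hc, hcd, hw⟩ := ih
    rw [← List.rotate_rotate, hw]
    obtain ⟨c, rfl⟩ := Nat.exists_eq_succ_of_ne_zero hc.ne'
    rcases Nat.eq_zero_or_pos c with rfl | hc'
    · have hj' : S.rotate (j + 1) = R ++ [s] := by
        rw [← List.rotate_rotate, hj]; simp
      have hs : s.2 = d + 1 := by omega
      obtain ⟨r, R', hr⟩ := List.exists_cons_of_ne_nil (l := R ++ [s]) (by simp)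
      have hmem : r ∈ S := by
        rw [← List.mem_rotate (n := j + 1), hj', hr]; simp
      refine ⟨j + 1, r, R', r.2, 0, by rw [hj', hr], hpos r hmem, rfl, ?_⟩
      have h : spell (R ++ [s]) = spell (r :: R') := by rw [hr]
      simp only [spell_append, spell_cons, spell_nil, hs] at h
      simp [← h, List.replicate_succ']
    · refine ⟨j, s, R, c, d + 1, hj, hc', by omega, ?_⟩
      simp [List.replicate_succ (n := c), List.replicate_succ' (n := d)]

/-- A common prefix that extends past the first syllable of two words determines it. -/
lemma prefix_replicate_append {L A B : List α} {x x' y y' : α} {c c' : ℕ}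
    (hxy : x ≠ y) (hxy' : x' ≠ y') (hc : 0 < c) (hc' : 0 < c')
    (hL : c < L.length) (hL' : c' < L.length)
    (h : L <+: List.replicate c x ++ y :: A) (h' : L <+: List.replicate c' x' ++ y' :: B) :
    x = x' ∧ c = c' ∧ ∃ L', L' <+: y :: A ∧ L' <+: y' :: B ∧ L.length = L'.length + c := by
  induction c generalizing c' L with
  | zero => omega
  | succ c ih =>
    obtain ⟨c', rfl⟩ := Nat.exists_eq_succ_of_ne_zero hc'.ne'
    obtain ⟨z, L, rfl⟩ := List.exists_cons_of_length_pos (by omega : 0 < L.length)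
    simp only [List.replicate_succ, List.cons_append, List.cons_prefix_cons,
      List.length_cons, Nat.succ_eq_add_one] at h h' hL hL'
    obtain ⟨rfl, h⟩ := h
    obtain ⟨rfl, h'⟩ := h'
    refine ⟨rfl, ?_⟩
    obtain ⟨u, L₁, rfl⟩ := List.exists_cons_of_length_pos (by omega : 0 < L.length)
    rcases Nat.eq_zero_or_pos c with rfl | hc₀ <;> rcases Nat.eq_zero_or_pos c' with rfl | hc₀'
    · exact ⟨rfl, u :: L₁, by simpa using h, by simpa using h', rfl⟩
    · obtain ⟨k, rfl⟩ := Nat.exists_eq_succ_of_ne_zero hc₀'.ne'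
      simp [List.replicate_succ, List.cons_prefix_cons] at h h'
      exact absurd (h'.1.symm.trans h.1) hxy
    · obtain ⟨k, rfl⟩ := Nat.exists_eq_succ_of_ne_zero hc₀.ne'
      simp [List.replicate_succ, List.cons_prefix_cons] at h h'
      exact absurd (h.1.symm.trans h'.1) hxy'
    · obtain ⟨-, rfl, L', h₁, h₂, h₃⟩ := ih hc₀ hc₀' (by omega) (by omega) h h'
      exact ⟨rfl, L', h₁, h₂, by simp at h₃ ⊢; omega⟩

lemma mk_spell_flatMap {β : Type*} (l : List β) (f : β → List ((α × Bool) × ℕ)) :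
    FreeGroup.mk (spell (l.flatMap f)) = (l.map fun i => FreeGroup.mk (spell (f i))).prod := by
  induction l with
  | nil => rfl
  | cons i l ih => simp [← ih, FreeGroup.mul_mk]

lemma isReduced_spell {S : List ((α × Bool) × ℕ)} (hpos : ∀ s ∈ S, 0 < s.2)
    (hS : S.IsChain fun s t => s.1.1 ≠ t.1.1) : FreeGroup.IsReduced (spell S) := by
  have hne : [] ∉ S.map fun s => List.replicate s.2 s.1 := by
    intro h
    obtain ⟨s, hs, h⟩ := List.mem_map.1 h
    have := hpos s hs
    simp at h
    omega
  rw [spell, List.flatMap_def, FreeGroup.IsReduced, List.isChain_flatten hne]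
  refine ⟨?_, ?_⟩
  · intro l hl
    obtain ⟨s, -, rfl⟩ := List.mem_map.1 hl
    exact List.isChain_replicate_of_rel _ fun _ => rfl
  · rw [List.isChain_map]
    refine hS.imp fun s t hst x hx y hy h => absurd h ?_
    have hx := List.eq_of_mem_replicate (List.mem_of_mem_getLast? hx)
    have hy := List.eq_of_mem_replicate (List.mem_of_mem_head? hy)
    rwa [hx, hy]

lemma invRev_spell (S : List ((α × Bool) × ℕ)) :
    FreeGroup.invRev (spell S) = spell (S.map fun s => ((s.1.1, !s.1.2), s.2)).reverse := by
  induction S with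
  | nil => rfl
  | cons s S ih =>
    rw [spell_cons, FreeGroup.invRev_append, ih]
    simp [FreeGroup.invRev]

end Spell

/-- The letter following `p` in the relators: the other generator, with the same sign. -/
def otherLetter (p : Fin 2 × Bool) : Fin 2 × Bool := (1 - p.1, p.2)

/-- The syllables of `R(p, q)` with `q = otherLetter p`. -/
def relSyllables (p : Fin 2 × Bool) : List ((Fin 2 × Bool) × ℕ) :=
  (List.range 100).flatMap fun i => [(p, i + 1), (otherLetter p, i + 101)]

/-- The syllables of `R(p, q)`, read forwards or backwards. -/
def orientedSyllables (fwd : Bool) (p : Fin 2 × Bool) : List ((Fin 2 × Bool) × ℕ) :=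
  bif fwd then relSyllables p else (relSyllables p).reverse

/-- Recovers the orientation, the first letter and the position from two consecutive syllables,
the first one being at index one of the rotated list. -/
def locate (r₁ r₂ : (Fin 2 × Bool) × ℕ) : Bool × (Fin 2 × Bool) × ℕ :=
  bif r₁.2.ble 100 then
    bif (r₁.2 + 100).beq r₂.2 then (true, r₁.1, (2 * r₁.2 + 197) % 200)
    else (false, r₁.1, 200 - 2 * r₁.2)
  else
    bif (r₂.2 + 100).beq r₁.2 then (false, r₂.1, (599 - 2 * r₁.2) % 200)
    else (true, r₂.1, 2 * r₁.2 - 202)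

/-- The properties of the first four syllables of a rotation by `j` needed to recognise it. -/
def recognizable (fwd : Bool) (p : Fin 2 × Bool) (j : ℕ) :
    List ((Fin 2 × Bool) × ℕ) → Prop
  | s :: r₁ :: r₂ :: r₃ :: _ => locate r₁ r₂ = (fwd, p, j) ∧ s.1 ≠ r₁.1 ∧ r₁.1 ≠ r₂.1 ∧
      r₂.1 ≠ r₃.1 ∧ s.2 ≤ 200 ∧ r₁.2 ≤ 200 ∧ r₂.2 ≤ 200 ∧ 0 < r₁.2 ∧ 0 < r₂.2 ∧ 0 < r₃.2
  | _ => False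

instance (fwd : Bool) (p : Fin 2 × Bool) (j : ℕ) (T : List ((Fin 2 × Bool) × ℕ)) :
    Decidable (recognizable fwd p j T) :=
  match T with
  | _ :: _ :: _ :: _ :: _ => inferInstanceAs (Decidable (_ ∧ _))
  | [] | [_] | [_, _] | [_, _, _] => inferInstanceAs (Decidable False)

lemma recognizable_rotate : ∀ (fwd : Bool) (p : Fin 2 × Bool), ∀ j < 200,
    recognizable fwd p j ((orientedSyllables fwd p).rotate j) := by
  decide +kernel

lemma length_orientedSyllables : ∀ (fwd : Bool) (p : Fin 2 × Bool),
    (orientedSyllables fwd p).length = 200 := by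
  decide +kernel

lemma length_spell_orientedSyllables (fwd : Bool) (p : Fin 2 × Bool) :
    (spell (orientedSyllables fwd p)).length = 20100 := by
  rw [length_spell]
  revert fwd p
  decide +kernel

lemma orientedSyllables_pos : ∀ (fwd : Bool) (p : Fin 2 × Bool),
    ∀ s ∈ orientedSyllables fwd p, 0 < s.2 := by
  decide +kernel

lemma isChain_relSyllables : ∀ p : Fin 2 × Bool,
    (relSyllables p).IsChain fun s t => s.1.1 ≠ t.1.1 := by
  decide +kernel

lemma toWord_Rword (p : Fin 2 × Bool) :
    (Rword (FreeGroup.mk [p]) (FreeGroup.mk [otherLetter p])).toWord =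
      spell (relSyllables p) := by
  have h : Rword (FreeGroup.mk [p]) (FreeGroup.mk [otherLetter p]) =
      FreeGroup.mk (spell (relSyllables p)) := by
    rw [relSyllables, mk_spell_flatMap]
    simp [Rword, FreeGroup.mul_mk]
  rw [h, FreeGroup.toWord_mk]
  exact (isReduced_spell (orientedSyllables_pos true p) (isChain_relSyllables p)).reduce_eq

lemma exists_eq_Rword_of_mem_baseRels {w : FreeGroup (Fin 2)} (hw : w ∈ baseRels) :
    ∃ p, w = Rword (FreeGroup.mk [p]) (FreeGroup.mk [otherLetter p]) := by
  simp only [baseRels, Set.mem_insert_iff, Set.mem_singleton_iff] at hw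
  rcases hw with h | h | h | h
  exacts [⟨(0, true), h.trans (congrArg₂ Rword rfl rfl)⟩,
    ⟨(0, false), h.trans (congrArg₂ Rword rfl rfl)⟩,
    ⟨(1, true), h.trans (congrArg₂ Rword rfl rfl)⟩,
    ⟨(1, false), h.trans (congrArg₂ Rword rfl rfl)⟩]

lemma exists_orientedSyllables_of_mem_symRels {w : FreeGroup (Fin 2)} (hw : w ∈ symRels) :
    ∃ fwd p n, w.toWord = (spell (orientedSyllables fwd p)).rotate n := by
  obtain ⟨w₀, hw₀, n, h⟩ := hw
  obtain ⟨p, hp⟩ := exists_eq_Rword_of_mem_baseRels hw₀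
  rcases h with h | h
  · exact ⟨true, p, n, by rw [h, hp, toWord_Rword, orientedSyllables, cond_true]⟩
  · refine ⟨false, (p.1, !p.2), n, ?_⟩
    rw [h, hp, FreeGroup.toWord_inv, toWord_Rword, invRev_spell]
    simp [orientedSyllables, relSyllables, otherLetter, List.map_flatMap]

/-- The first four syllables of an element of `symRels`, the first one possibly truncated. -/
lemma exists_syllables_of_mem_symRels {w : FreeGroup (Fin 2)} (hw : w ∈ symRels) :
    ∃ (fwd : Bool) (p : Fin 2 × Bool) (j : ℕ) (s r₁ r₂ r₃ : (Fin 2 × Bool) × ℕ)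
      (R : List ((Fin 2 × Bool) × ℕ)) (c d : ℕ),
      (orientedSyllables fwd p).rotate j = s :: r₁ :: r₂ :: r₃ :: R ∧
      recognizable fwd p j (s :: r₁ :: r₂ :: r₃ :: R) ∧ 0 < c ∧ c + d = s.2 ∧
      w.toWord = List.replicate c s.1 ++ spell (r₁ :: r₂ :: r₃ :: R) ++ List.replicate d s.1 := by
  obtain ⟨fwd, p, n, hn⟩ := exists_orientedSyllables_of_mem_symRels hw
  have hlen := length_orientedSyllables fwd p
  obtain ⟨j, s, R, c, d, hj, hc, hcd, hrot⟩ := exists_rotate_spell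
    (by intro h; simp [h] at hlen) (orientedSyllables_pos fwd p) n
  rw [← List.rotate_mod, hlen] at hj
  have hrec := recognizable_rotate fwd p (j % 200) (Nat.mod_lt _ (by norm_num))
  rw [hj] at hrec
  match R, hrec, hj, hrot with
  | r₁ :: r₂ :: r₃ :: R, hrec, hj, hrot =>
    exact ⟨fwd, p, j % 200, s, r₁, r₂, r₃, R, c, d, hj, hrec, hc, hcd, hn.trans hrot⟩

lemma spell_cons_eq_cons {α : Type*} {r : α × ℕ} (hr : 0 < r.2) (R : List (α × ℕ)) (V : List α) :
    ∃ A, spell (r :: R) ++ V = r.1 :: A := by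
  obtain ⟨k, hk⟩ := Nat.exists_eq_succ_of_ne_zero hr.ne'
  exact ⟨_, by simp only [spell_cons, hk, List.replicate_succ, List.cons_append]; rfl⟩

/-- The symmetrized closure of `{R(a,b), R(a⁻¹,b⁻¹), R(b,a), R(b⁻¹,a⁻¹)}`
satisfies the small cancellation condition `C'(1/8)`: every piece (common
initial segment of the reduced words of two distinct elements of the set) `p`
of a word `w` in the set satisfies `|p| < |w| / 8`. -/
theorem baseRels_C'_one_eighth :
    ∀ w₁ ∈ symRels, ∀ w₂ ∈ symRels, w₁ ≠ w₂ →
      ∀ L : List (Fin 2 × Bool),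
        L <+: FreeGroup.toWord w₁ → L <+: FreeGroup.toWord w₂ →
        8 * L.length < (FreeGroup.toWord w₁).length := by
  intro w₁ hw₁ w₂ hw₂ hne L hL₁ hL₂
  have hlen : (FreeGroup.toWord w₁).length = 20100 := by
    obtain ⟨fwd, p, n, h⟩ := exists_orientedSyllables_of_mem_symRels hw₁
    rw [h, List.length_rotate, length_spell_orientedSyllables]
  rw [hlen]
  by_contra! hlong
  apply hne
  apply FreeGroup.toWord_injective
  obtain ⟨fwd, p, j, s, r₁, r₂, r₃, R, c, d, hrot, ⟨hloc, h₁, h₂, h₃, b₀, b₁, b₂, p₁, p₂, p₃⟩,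
    hc, hcd, hw⟩ := exists_syllables_of_mem_symRels hw₁
  obtain ⟨fwd', p', j', s', r₁', r₂', r₃', R', c', d', hrot',
    ⟨hloc', h₁', h₂', h₃', b₀', b₁', b₂', p₁', p₂', p₃'⟩, hc', hcd', hw'⟩ :=
    exists_syllables_of_mem_symRels hw₂
  rw [hw] at hL₁ ⊢
  rw [hw'] at hL₂ ⊢
  rw [List.append_assoc] at hL₁ hL₂
  obtain ⟨A₁, hA₁⟩ := spell_cons_eq_cons p₁ (r₂ :: r₃ :: R) (List.replicate d s.1)
  obtain ⟨A₁', hA₁'⟩ := spell_cons_eq_cons p₁' (r₂' :: r₃' :: R') (List.replicate d' s'.1)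
  obtain ⟨A₂, hA₂⟩ := spell_cons_eq_cons p₂ (r₃ :: R) (List.replicate d s.1)
  obtain ⟨A₂', hA₂'⟩ := spell_cons_eq_cons p₂' (r₃' :: R') (List.replicate d' s'.1)
  obtain ⟨A₃, hA₃⟩ := spell_cons_eq_cons p₃ R (List.replicate d s.1)
  obtain ⟨A₃', hA₃'⟩ := spell_cons_eq_cons p₃' R' (List.replicate d' s'.1)
  rw [hA₁] at hL₁
  rw [hA₁'] at hL₂
  obtain ⟨-, hcc, L₁, hL₁, hL₂, hl₁⟩ := prefix_replicate_append h₁ h₁' hc hc'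
    (by omega) (by omega) hL₁ hL₂
  rw [← hA₁, spell_cons, List.append_assoc, hA₂] at hL₁
  rw [← hA₁', spell_cons, List.append_assoc, hA₂'] at hL₂
  obtain ⟨hx₁, he₁, L₂, hL₁, hL₂, hl₂⟩ := prefix_replicate_append h₂ h₂' p₁ p₁'
    (by omega) (by omega) hL₁ hL₂
  rw [← hA₂, spell_cons, List.append_assoc, hA₃] at hL₁
  rw [← hA₂', spell_cons, List.append_assoc, hA₃'] at hL₂
  obtain ⟨hx₂, he₂, -⟩ := prefix_replicate_append h₃ h₃' p₂ p₂' (by omega) (by omega) hL₁ hL₂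
  rw [Prod.ext hx₁ he₁, Prod.ext hx₂ he₂, hloc'] at hloc
  obtain ⟨rfl, rfl, rfl⟩ : fwd' = fwd ∧ p' = p ∧ j' = j := by simpa using hloc
  obtain ⟨rfl, hR⟩ := List.cons.inj (hrot.symm.trans hrot')
  rw [hR, hcc, show d = d' by omega]
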